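/- Let n ≥ 1 be an integer and δ ∈ ℝ, and define α_δ(r) = (∫₀^r sn_δ(t)^{n−1} dt) / sn_δ(r)^{n−1}. Then α_δ is nondecreasing on the interval (0, π/√δ) when δ > 0, and on (0, ∞) when δ ≤ 0. (This is the monotonicity part of Corollary 2.6 of the paper, where α_δ = V^n_δ/A^{n−1}_δ is the ratio of the volume of a geodesic ball to the volume of a geodesic sphere of the same radius in the n-dimensional space form of curvature δ.) -/

import Mathlib

open Real intervalIntegral

/-- `sn_δ` from the paper. -/
noncomputable def snDelta (δ t : ℝ) : ℝ :=
  if 0 < δ then Real.sin (Real.sqrt δ * t) / Real.sqrt δ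
  else if δ = 0 then t
  else Real.sinh (Real.sqrt (-δ) * t) / Real.sqrt (-δ)

/-- The function `α_δ(r) = (∫₀^r sn_δ(t)^{n-1} dt) / sn_δ(r)^{n-1}`. -/
noncomputable def alphaDelta (n : ℕ) (δ r : ℝ) : ℝ :=
  (∫ t in (0:ℝ)..r, snDelta δ t ^ (n - 1)) / snDelta δ r ^ (n - 1)

theorem snDelta_of_pos {δ : ℝ} (hδ : 0 < δ) (t : ℝ) :
    snDelta δ t = Real.sin (Real.sqrt δ * t) / Real.sqrt δ := if_pos hδ

theorem snDelta_zero (t : ℝ) : snDelta 0 t = t := by simp [snDelta]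

theorem snDelta_of_neg {δ : ℝ} (hδ : δ < 0) (t : ℝ) :
    snDelta δ t = Real.sinh (Real.sqrt (-δ) * t) / Real.sqrt (-δ) := by
  simp [snDelta, hδ.not_gt, hδ.ne]

theorem continuous_snDelta (δ : ℝ) : Continuous (snDelta δ) := by
  rcases lt_trichotomy δ 0 with h | rfl | h
  · rw [funext (snDelta_of_neg h)]
    fun_prop
  · rw [funext snDelta_zero]
    fun_prop
  · rw [funext (snDelta_of_pos h)]
    fun_prop

theorem snDelta_apply_zero (δ : ℝ) : snDelta δ 0 = 0 := by simp [snDelta]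

theorem snDelta_sub_mul_sub (δ a b u : ℝ) :
    snDelta δ (b - u) * snDelta δ a - snDelta δ (a - u) * snDelta δ b =
      snDelta δ u * snDelta δ (b - a) := by
  rcases lt_trichotomy δ 0 with h | rfl | h
  · simp only [snDelta_of_neg h, mul_sub, Real.sinh_sub]
    ring
  · simp only [snDelta_zero]
    ring
  · simp only [snDelta_of_pos h, mul_sub, Real.sin_sub]
    ring

theorem snDelta_pos_of_pos {δ t : ℝ} (hδ : 0 < δ) (ht : t ∈ Set.Ioo 0 (π / √δ)) :
    0 < snDelta δ t := by
  have hs : 0 < √δ := Real.sqrt_pos.2 hδ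
  rw [snDelta_of_pos hδ]
  exact div_pos (Real.sin_pos_of_pos_of_lt_pi (mul_pos hs ht.1)
    (by rw [mul_comm]; exact (lt_div_iff₀ hs).1 ht.2)) hs

theorem snDelta_pos_of_nonpos {δ t : ℝ} (hδ : δ ≤ 0) (ht : 0 < t) : 0 < snDelta δ t := by
  rcases hδ.lt_or_eq with h | rfl
  · have hs : 0 < √(-δ) := Real.sqrt_pos.2 (neg_pos.2 h)
    rw [snDelta_of_neg h]
    exact div_pos (Real.sinh_pos_iff.2 (mul_pos hs ht)) hs
  · rwa [snDelta_zero]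

/-- After the substitution `t ↦ r - u`, the integrand `(sn_δ (r - u) / sn_δ r) ^ (n - 1)` is
nondecreasing in `r`. -/
theorem alphaDelta_le_alphaDelta (n : ℕ) {δ a b : ℝ} (ha : 0 < a) (hab : a ≤ b)
    (hpos : ∀ t, 0 < t → t ≤ b → 0 < snDelta δ t) : alphaDelta n δ a ≤ alphaDelta n δ b := by
  have hnonneg : ∀ t, 0 ≤ t → t ≤ b → 0 ≤ snDelta δ t := fun t h0 hb ↦ by
    rcases h0.eq_or_lt with rfl | h
    · exact (snDelta_apply_zero δ).ge
    · exact (hpos t h hb).le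
  have hcont := continuous_snDelta δ
  have hsa := hpos a ha hab
  have hsb := hpos b (ha.trans_le hab) le_rfl
  have hrefl : ∀ r, ∫ t in (0 : ℝ)..r, snDelta δ t ^ (n - 1) =
      ∫ u in (0 : ℝ)..r, snDelta δ (r - u) ^ (n - 1) := fun r ↦ by
    simp [integral_comp_sub_left (fun t ↦ snDelta δ t ^ (n - 1)) r]
  have hint : ∀ r x y, IntervalIntegrable (fun u ↦ snDelta δ (r - u) ^ (n - 1))
      MeasureTheory.volume x y := fun r x y ↦
    Continuous.intervalIntegrable (by fun_prop) x y
  rw [alphaDelta, alphaDelta, div_le_div_iff₀ (pow_pos hsa _) (pow_pos hsb _), hrefl a, hrefl b]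
  calc (∫ u in (0 : ℝ)..a, snDelta δ (a - u) ^ (n - 1)) * snDelta δ b ^ (n - 1)
      = ∫ u in (0 : ℝ)..a, snDelta δ (a - u) ^ (n - 1) * snDelta δ b ^ (n - 1) :=
        (integral_mul_const _ _).symm
    _ ≤ ∫ u in (0 : ℝ)..a, snDelta δ (b - u) ^ (n - 1) * snDelta δ a ^ (n - 1) := by
        refine integral_mono_on ha.le ((hint a 0 a).mul_const _) ((hint b 0 a).mul_const _)
          fun u hu ↦ ?_
        rw [← mul_pow, ← mul_pow]
        refine pow_le_pow_left₀ (mul_nonneg (hnonneg _ (by linarith [hu.2])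
          (by linarith [hu.1])) hsb.le) ?_ _
        have := mul_nonneg (hnonneg u hu.1 (hu.2.trans hab))
          (hnonneg (b - a) (by linarith) (by linarith))
        linarith [snDelta_sub_mul_sub δ a b u]
    _ = (∫ u in (0 : ℝ)..a, snDelta δ (b - u) ^ (n - 1)) * snDelta δ a ^ (n - 1) :=
        integral_mul_const _ _
    _ ≤ (∫ u in (0 : ℝ)..b, snDelta δ (b - u) ^ (n - 1)) * snDelta δ a ^ (n - 1) := by
        refine mul_le_mul_of_nonneg_right ?_ (pow_pos hsa _).le
        rw [← integral_add_adjacent_intervals (hint b 0 a) (hint b a b)]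
        refine le_add_of_nonneg_right (integral_nonneg hab fun u hu ↦ ?_)
        exact pow_nonneg (hnonneg _ (by linarith [hu.2]) (by linarith [hu.1])) _

/-- Monotonicity part of Corollary 2.6: `α_δ` is nondecreasing on `(0, π/√δ)`
when `δ > 0`, and on `(0, ∞)` when `δ ≤ 0`. -/
theorem alphaDelta_monotoneOn (n : ℕ) (hn : 1 ≤ n) (δ : ℝ) :
    (0 < δ → MonotoneOn (alphaDelta n δ) (Set.Ioo 0 (Real.pi / Real.sqrt δ))) ∧
    (δ ≤ 0 → MonotoneOn (alphaDelta n δ) (Set.Ioi 0)) :=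
  ⟨fun hδ _ ha _ hb hab ↦ alphaDelta_le_alphaDelta n ha.1 hab fun _ h0 h1 ↦
      snDelta_pos_of_pos hδ ⟨h0, h1.trans_lt hb.2⟩,
    fun hδ _ ha _ _ hab ↦ alphaDelta_le_alphaDelta n ha hab fun _ h0 _ ↦
      snDelta_pos_of_nonpos hδ h0⟩
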